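/- arXiv:1812.03077 — 3 statements merged into one kernel-verified Lean document; each statement's English description precedes it below -/
import Mathlib

section
/- Let H₁ and H₂ be real Hilbert spaces and let k ∈ ℕ, k ≥ 1. For a bounded linear operator T : H₁ → H₂ define λ_k(T) = sup{ inf{ ‖Tx‖ : x ∈ V, ‖x‖ = 1 } : V a k-dimensional linear subspace of H₁ }. Let (T_n)_n be a sequence of bounded linear operators from H₁ to H₂ with sup_n ‖T_n‖ < ∞, and let T : H₁ → H₂ be a bounded linear operator such that T_n x converges weakly in H₂ to T x for every x ∈ H₁. Then λ_k(T) ≤ liminf_n λ_k(T_n). -/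
open Filter

/-- The Courant–Fischer min-max quantity
`λ_k(T) = sup { inf { ‖Tx‖ : x ∈ V, ‖x‖ = 1 } : V a k-dimensional subspace of H₁ }`,
which for compact operators between Hilbert spaces is the `k`-th singular value of `T`
in nonincreasing order. -/
noncomputable def minMaxSingularValue {H₁ H₂ : Type*}
    [NormedAddCommGroup H₁] [InnerProductSpace ℝ H₁]
    [NormedAddCommGroup H₂] [InnerProductSpace ℝ H₂]
    (k : ℕ) (T : H₁ →L[ℝ] H₂) : ℝ :=
  sSup {r : ℝ | ∃ V : Submodule ℝ H₁, Module.finrank ℝ V = k ∧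
    r = sInf {s : ℝ | ∃ x : H₁, x ∈ V ∧ ‖x‖ = 1 ∧ s = ‖T x‖}}

/-- The norm is lower semicontinuous along weakly convergent families. -/
theorem eventually_lt_norm_of_tendsto_inner {ι H : Type*} {l : Filter ι}
    [NormedAddCommGroup H] [InnerProductSpace ℝ H] {u : ι → H} {v : H} {a : ℝ}
    (h : Tendsto (fun i => (inner ℝ (u i) v : ℝ)) l (nhds (inner ℝ v v))) (ha : a < ‖v‖) :
    ∀ᶠ i in l, a < ‖u i‖ := by
  rcases lt_or_ge a 0 with h0 | h0
  · exact Eventually.of_forall fun i => h0.trans_le (norm_nonneg _)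
  have hv : 0 < ‖v‖ := h0.trans_lt ha
  have hlt : a * ‖v‖ < inner ℝ v v := by
    rw [real_inner_self_eq_norm_mul_norm]
    exact mul_lt_mul_of_pos_right ha hv
  filter_upwards [h.eventually_const_lt hlt] with i hi
  exact lt_of_mul_lt_mul_right (hi.trans_le (real_inner_le_norm _ _)) hv.le

section

variable {H₁ H₂ : Type*} [NormedAddCommGroup H₁] [InnerProductSpace ℝ H₁]
  [NormedAddCommGroup H₂] [InnerProductSpace ℝ H₂]

theorem Submodule.exists_mem_norm_eq_one {k : ℕ} (hk : 1 ≤ k) {V : Submodule ℝ H₁}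
    (hV : Module.finrank ℝ V = k) : ∃ x ∈ V, ‖x‖ = 1 := by
  have : Nontrivial V := Module.nontrivial_of_finrank_pos (R := ℝ) (by omega)
  obtain ⟨x, hx⟩ := exists_norm_eq V zero_le_one
  exact ⟨x, x.2, hx⟩

theorem sInf_norm_le (T : H₁ →L[ℝ] H₂) {V : Submodule ℝ H₁} {x : H₁} (hx : x ∈ V)
    (hx1 : ‖x‖ = 1) : sInf {s : ℝ | ∃ x : H₁, x ∈ V ∧ ‖x‖ = 1 ∧ s = ‖T x‖} ≤ ‖T x‖ :=
  csInf_le ⟨0, by rintro _ ⟨y, -, -, rfl⟩; exact norm_nonneg _⟩ ⟨x, hx, hx1, rfl⟩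

theorem sInf_norm_le_opNorm {k : ℕ} (hk : 1 ≤ k) (T : H₁ →L[ℝ] H₂) {V : Submodule ℝ H₁}
    (hV : Module.finrank ℝ V = k) :
    sInf {s : ℝ | ∃ x : H₁, x ∈ V ∧ ‖x‖ = 1 ∧ s = ‖T x‖} ≤ ‖T‖ := by
  obtain ⟨x, hx, hx1⟩ := Submodule.exists_mem_norm_eq_one hk hV
  exact (sInf_norm_le T hx hx1).trans (T.unit_le_opNorm x hx1.le)

theorem minMaxSingularValue_le_opNorm {k : ℕ} (hk : 1 ≤ k) (T : H₁ →L[ℝ] H₂) :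
    minMaxSingularValue k T ≤ ‖T‖ := by
  refine Real.sSup_le ?_ (norm_nonneg _)
  rintro _ ⟨V, hV, rfl⟩
  exact sInf_norm_le_opNorm hk T hV

theorem minMaxSingularValue_nonneg (k : ℕ) (T : H₁ →L[ℝ] H₂) :
    0 ≤ minMaxSingularValue k T := by
  refine Real.sSup_nonneg ?_
  rintro _ ⟨V, -, rfl⟩
  refine Real.sInf_nonneg ?_
  rintro _ ⟨x, -, -, rfl⟩
  exact norm_nonneg _

theorem le_minMaxSingularValue {k : ℕ} (hk : 1 ≤ k) (T : H₁ →L[ℝ] H₂) {V : Submodule ℝ H₁}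
    (hV : Module.finrank ℝ V = k) {a : ℝ} (ha : ∀ x ∈ V, ‖x‖ = 1 → a ≤ ‖T x‖) :
    a ≤ minMaxSingularValue k T := by
  have hle : a ≤ sInf {s : ℝ | ∃ x : H₁, x ∈ V ∧ ‖x‖ = 1 ∧ s = ‖T x‖} := by
    obtain ⟨x, hx, hx1⟩ := Submodule.exists_mem_norm_eq_one hk hV
    refine le_csInf ⟨_, x, hx, hx1, rfl⟩ ?_
    rintro _ ⟨y, hy, hy1, rfl⟩
    exact ha y hy hy1
  refine hle.trans (le_csSup ⟨‖T‖, ?_⟩ ⟨V, hV, rfl⟩)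
  rintro _ ⟨W, hW, rfl⟩
  exact sInf_norm_le_opNorm hk T hW

/-- For a uniformly bounded family of operators, a strict lower bound on the norms of the images
which eventually holds at a point persists, up to a loss, locally uniformly. -/
theorem eventually_prod_lt_norm_apply {ι : Type*} {l : Filter ι} {S : ι → H₁ →L[ℝ] H₂} {M : ℝ}
    (hM : ∀ i, ‖S i‖ ≤ M) {x : H₁} {a b : ℝ} (hab : a < b) (hb : ∀ᶠ i in l, b < ‖S i x‖) :
    ∀ᶠ p : H₁ × ι in nhds x ×ˢ l, a < ‖S p.2 p.1‖ := by
  have hnear : ∀ᶠ y in nhds x, M * ‖x - y‖ < b - a := by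
    have hc : Continuous fun y : H₁ => M * ‖x - y‖ := by fun_prop
    refine hc.continuousAt.eventually_lt_const ?_
    simpa using hab
  filter_upwards [hnear.prod_mk hb] with p hp
  have hle : ‖S p.2 x - S p.2 p.1‖ ≤ M * ‖x - p.1‖ := by
    rw [← map_sub]
    exact (S p.2).le_of_opNorm_le (hM _) _
  linarith [hp.1, hp.2, norm_sub_norm_le (S p.2 x) (S p.2 p.1)]

theorem Submodule.isCompact_norm_eq_one (V : Submodule ℝ H₁) [FiniteDimensional ℝ V] :
    IsCompact {x : H₁ | x ∈ V ∧ ‖x‖ = 1} := by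
  convert (isCompact_sphere (0 : V) 1).image continuous_subtype_val using 1
  ext x
  simp [and_comm]

end

/-- Let `H₁, H₂` be real Hilbert spaces, `k ≥ 1`, and let `(T_n)` be a
uniformly bounded sequence of bounded operators `H₁ → H₂` such that `T_n x ⇀ T x` weakly
in `H₂` for every `x`. Then `λ_k(T) ≤ liminf_n λ_k(T_n)`. -/
theorem stmt6 {H₁ H₂ : Type*}
    [NormedAddCommGroup H₁] [InnerProductSpace ℝ H₁] [CompleteSpace H₁]
    [NormedAddCommGroup H₂] [InnerProductSpace ℝ H₂] [CompleteSpace H₂]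
    (k : ℕ) (hk : 1 ≤ k)
    (T : H₁ →L[ℝ] H₂) (Tn : ℕ → H₁ →L[ℝ] H₂)
    (hbdd : ∃ M : ℝ, ∀ n, ‖Tn n‖ ≤ M)
    (hweak : ∀ (x : H₁) (y : H₂),
      Tendsto (fun n => (inner ℝ ((Tn n) x) y : ℝ)) atTop (nhds (inner ℝ (T x) y))) :
    minMaxSingularValue k T ≤ liminf (fun n => minMaxSingularValue k (Tn n)) atTop := by
  obtain ⟨M, hM⟩ := hbdd
  have hcobdd : IsCoboundedUnder (· ≥ ·) atTop fun n => minMaxSingularValue k (Tn n) :=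
    (isBoundedUnder_of
      ⟨M, fun n => (minMaxSingularValue_le_opNorm hk (Tn n)).trans (hM n)⟩).isCoboundedUnder_ge
  refine Real.sSup_le ?_ (le_liminf_of_le hcobdd
    (Eventually.of_forall fun n => minMaxSingularValue_nonneg k (Tn n)))
  rintro _ ⟨V, hV, rfl⟩
  have : FiniteDimensional ℝ V := FiniteDimensional.of_finrank_pos (by omega)
  refine le_of_forall_lt fun c hc => ?_
  obtain ⟨a, hca, ha⟩ := exists_between hc
  obtain ⟨b, hab, hb⟩ := exists_between ha
  refine hca.trans_le (le_liminf_of_le hcobdd ?_)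
  have hunif : ∀ᶠ n in atTop, ∀ x ∈ {x : H₁ | x ∈ V ∧ ‖x‖ = 1}, a < ‖Tn n x‖ := by
    suffices h : ∀ᶠ p : H₁ × ℕ in nhdsSet {x : H₁ | x ∈ V ∧ ‖x‖ = 1} ×ˢ atTop,
        a < ‖Tn p.2 p.1‖ from
      (eventually_swap_iff.mp h).curry.mono fun _ hn => hn.self_of_nhdsSet
    refine (Submodule.isCompact_norm_eq_one V).mem_nhdsSet_prod_of_forall ?_
    rintro x ⟨hx, hx1⟩
    exact eventually_prod_lt_norm_apply hM hab (eventually_lt_norm_of_tendsto_inner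
      (hweak x (T x)) (hb.trans_le (sInf_norm_le T hx hx1)))
  filter_upwards [hunif] with n hn
  exact le_minMaxSingularValue hk (Tn n) hV fun x hx hx1 => (hn x ⟨hx, hx1⟩).le
end

section
/- Let m, n ∈ ℕ, let φ : [0,∞) → [0,∞) be nondecreasing and let τ, ρ > 0 be such that the function x ↦ x²/(2τ) + ρφ(x) is convex on [0,∞). Then the function G on real m×n matrices defined by G(A) = ‖A‖_F²/(2τ) + ρ ∑_{i=1}^{min(m,n)} φ(σ_i(A)) is convex; consequently, for any fixed real m×n matrix A₀, the function H(A) = ‖A − A₀‖_F²/(2τ) + ρ ∑_{i=1}^{min(m,n)} φ(σ_i(A)) is convex. -/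
open Matrix
/-- The rectangular matrix `Aᵀ * A` is Hermitian (real symmetric). -/
theorem transpose_mul_self_isHermitian {m n : ℕ} (A : Matrix (Fin m) (Fin n) ℝ) :
    (Aᵀ * A).IsHermitian := by
  have := Matrix.isHermitian_conjTranspose_mul_self A
  rwa [Matrix.conjTranspose_eq_transpose_of_trivial] at this

/-- The singular values `σ₁(A) ≥ … ≥ σ_{min(m,n)}(A) ≥ 0` of a real `m×n` matrix `A`:
the `min(m,n)` largest nonnegative square roots of the eigenvalues of `AᵀA`, listed with
multiplicity in nonincreasing order (obtained by sorting the eigenvalues of `AᵀA` in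
nondecreasing order and reading them backwards). -/
noncomputable def singVals {m n : ℕ} (A : Matrix (Fin m) (Fin n) ℝ) :
    Fin (min m n) → ℝ := fun i =>
  Real.sqrt ((transpose_mul_self_isHermitian A).eigenvalues
    (Tuple.sort (transpose_mul_self_isHermitian A).eigenvalues
      ⟨n - 1 - (i : ℕ), by have := i.isLt; omega⟩))

/-- A finite family of vectors satisfying Bessel's inequality. -/
def IsBessel {ι κ : Type*} [Fintype ι] [Fintype κ] (u : ι → κ → ℝ) : Prop :=
  ∀ x : κ → ℝ, ∑ i, (u i ⬝ᵥ x) ^ 2 ≤ x ⬝ᵥ x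

namespace IsBessel

variable {ι κ : Type*} [Fintype ι] [Fintype κ] {u : ι → κ → ℝ}

theorem of_orthogonal (horth : ∀ i j, i ≠ j → u i ⬝ᵥ u j = 0)
    (hle : ∀ i, u i ⬝ᵥ u i ≤ 1) : IsBessel u := by
  classical
  intro x
  have hself : (∑ i, (u i ⬝ᵥ x) • u i) ⬝ᵥ (∑ i, (u i ⬝ᵥ x) • u i)
      = ∑ i, (u i ⬝ᵥ x) ^ 2 * (u i ⬝ᵥ u i) := by
    rw [sum_dotProduct]
    refine Finset.sum_congr rfl fun i _ => ?_
    rw [dotProduct_sum, Finset.sum_eq_single i]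
    · simp only [smul_dotProduct, dotProduct_smul, smul_eq_mul]; ring
    · intro j _ hj
      simp [horth i j hj.symm]
    · simp
  have hcross : (∑ i, (u i ⬝ᵥ x) • u i) ⬝ᵥ x = ∑ i, (u i ⬝ᵥ x) ^ 2 := by
    rw [sum_dotProduct]
    refine Finset.sum_congr rfl fun i _ => ?_
    simp only [smul_dotProduct, smul_eq_mul]; ring
  have hpos : 0 ≤ (x - ∑ i, (u i ⬝ᵥ x) • u i) ⬝ᵥ (x - ∑ i, (u i ⬝ᵥ x) • u i) :=
    Finset.sum_nonneg fun k _ => mul_self_nonneg _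
  rw [sub_dotProduct, dotProduct_sub, dotProduct_sub, hself, hcross,
    dotProduct_comm x (∑ i, (u i ⬝ᵥ x) • u i), hcross] at hpos
  have hsum : ∑ i, (u i ⬝ᵥ x) ^ 2 * (u i ⬝ᵥ u i) ≤ ∑ i, (u i ⬝ᵥ x) ^ 2 :=
    Finset.sum_le_sum fun i _ => mul_le_of_le_one_right (sq_nonneg _) (hle i)
  linarith

theorem dotProduct_self_le_one (hu : IsBessel u) (i : ι) : u i ⬝ᵥ u i ≤ 1 := by
  have h : (u i ⬝ᵥ u i) ^ 2 ≤ u i ⬝ᵥ u i :=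
    (Finset.single_le_sum (f := fun j => (u j ⬝ᵥ u i) ^ 2)
      (fun j _ => sq_nonneg _) (Finset.mem_univ i)).trans (hu (u i))
  nlinarith

theorem sum_sq_dotProduct_le_one {ι' : Type*} [Fintype ι'] {p : ι' → κ → ℝ}
    (hu : IsBessel u) (hp : IsBessel p) (k : ι') : ∑ i, (u i ⬝ᵥ p k) ^ 2 ≤ 1 :=
  (hu (p k)).trans (hp.dotProduct_self_le_one k)

end IsBessel

/-- Indices of the `min m n` largest eigenvalues of `Aᵀ * A`, in the order used by `singVals`. -/
noncomputable def singIdx {m n : ℕ} (A : Matrix (Fin m) (Fin n) ℝ) (i : Fin (min m n)) : Fin n :=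
  Tuple.sort (transpose_mul_self_isHermitian A).eigenvalues
    ⟨n - 1 - (i : ℕ), by have := i.isLt; omega⟩

section SVD

variable {m n : ℕ} (A : Matrix (Fin m) (Fin n) ℝ)

theorem singIdx_injective : Function.Injective (singIdx A) := by
  intro i j h
  have h' := (Tuple.sort (transpose_mul_self_isHermitian A).eigenvalues).injective h
  have hi := i.isLt
  have hj := j.isLt
  simp only [Fin.mk.injEq] at h'
  ext
  omega

theorem eigenvalues_transpose_mul_self_nonneg (j : Fin n) :
    0 ≤ (transpose_mul_self_isHermitian A).eigenvalues j := by
  have h := Matrix.posSemidef_conjTranspose_mul_self A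
  rw [Matrix.conjTranspose_eq_transpose_of_trivial] at h
  exact h.eigenvalues_nonneg j

theorem singVals_nonneg (i : Fin (min m n)) : 0 ≤ singVals A i :=
  Real.sqrt_nonneg _

theorem singVals_sq (i : Fin (min m n)) :
    singVals A i ^ 2 = (transpose_mul_self_isHermitian A).eigenvalues (singIdx A i) :=
  Real.sq_sqrt (eigenvalues_transpose_mul_self_nonneg A _)

theorem eigenvalues_eq_zero_of_notMem_range_singIdx {j : Fin n} (hj : j ∉ Set.range (singIdx A)) :
    (transpose_mul_self_isHermitian A).eigenvalues j = 0 := by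
  set hA := transpose_mul_self_isHermitian A
  by_contra hne
  obtain ⟨p, rfl⟩ := (Tuple.sort hA.eigenvalues).surjective j
  have hp : (p : ℕ) + min m n < n := by
    by_contra hlt
    have := p.isLt
    refine hj ⟨⟨n - 1 - p, by omega⟩, ?_⟩
    simp only [singIdx]
    congr 2
    omega
  have hpos : ∀ q, p ≤ q → hA.eigenvalues (Tuple.sort hA.eigenvalues q) ≠ 0 := fun q hq =>
    (((eigenvalues_transpose_mul_self_nonneg A _).lt_of_ne' hne).trans_le
      (Tuple.monotone_sort hA.eigenvalues hq)).ne'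
  have hcard : Fintype.card {j // hA.eigenvalues j ≠ 0} ≤ min m n := by
    rw [← hA.rank_eq_card_non_zero_eigs, Matrix.rank_transpose_mul_self]
    exact le_min (by simpa using A.rank_le_height) (by simpa using A.rank_le_width)
  have hinj : Fintype.card {q // p ≤ q} ≤ Fintype.card {j // hA.eigenvalues j ≠ 0} :=
    Fintype.card_le_of_injective (fun q => ⟨Tuple.sort hA.eigenvalues q.1, hpos q.1 q.2⟩)
      fun a b hab => Subtype.ext
        ((Tuple.sort hA.eigenvalues).injective (congrArg Subtype.val hab))
  have hIci : Fintype.card {q // p ≤ q} = n - p := by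
    rw [Fintype.card_subtype, ← Fin.card_Ici]
    congr 1
    ext q
    simp
  omega

theorem sum_singIdx (g : Fin n → ℝ)
    (hg : ∀ j, (transpose_mul_self_isHermitian A).eigenvalues j = 0 → g j = 0) :
    ∑ i, g (singIdx A i) = ∑ j, g j := by
  classical
  rw [← Finset.sum_image (f := g) (s := Finset.univ) fun a _ b _ h => singIdx_injective A h]
  refine Finset.sum_subset (Finset.subset_univ _) fun j _ hj => hg j ?_
  refine eigenvalues_eq_zero_of_notMem_range_singIdx A fun ⟨i, hi⟩ => hj ?_
  exact Finset.mem_image.2 ⟨i, Finset.mem_univ i, hi⟩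

theorem sum_sq_eq_sum_singVals_sq : ∑ i, ∑ j, A i j ^ 2 = ∑ k, singVals A k ^ 2 := by
  simp_rw [singVals_sq]
  rw [sum_singIdx A _ fun _ h => h]
  have h := (transpose_mul_self_isHermitian A).trace_eq_sum_eigenvalues
  simp only [RCLike.ofReal_real_eq_id, id_eq] at h
  rw [← h, Finset.sum_comm]
  simp [Matrix.trace, Matrix.mul_apply, sq]

/-- Singular value decomposition, with left singular vectors allowed to vanish at zero
singular values. -/
theorem exists_singular_vectors :
    ∃ (u : Fin (min m n) → Fin m → ℝ) (v : Fin (min m n) → Fin n → ℝ),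
      IsBessel u ∧ IsBessel v ∧ (∀ i, u i ⬝ᵥ A *ᵥ v i = singVals A i) ∧
      ∀ x y, x ⬝ᵥ A *ᵥ y = ∑ k, singVals A k * ((u k ⬝ᵥ x) * (v k ⬝ᵥ y)) := by
  classical
  set hA := transpose_mul_self_isHermitian A
  let w : Fin n → Fin n → ℝ := fun j => (hA.eigenvectorBasis j).ofLp
  have horth : ∀ i j, w i ⬝ᵥ w j = if i = j then 1 else 0 := by
    intro i j
    have h := orthonormal_iff_ite.1 hA.eigenvectorBasis.orthonormal j i
    simp only [EuclideanSpace.inner_eq_star_dotProduct, star_trivial] at h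
    rw [h]
    simp [eq_comm]
  have heig : ∀ i j, A *ᵥ w i ⬝ᵥ A *ᵥ w j = if i = j then hA.eigenvalues i else 0 := by
    intro i j
    have h : (Aᵀ * A) *ᵥ w j = hA.eigenvalues j • w j := hA.mulVec_eigenvectorBasis j
    rw [dotProduct_mulVec, vecMul_mulVec, ← dotProduct_mulVec, h, dotProduct_smul, horth]
    by_cases hij : i = j <;> simp [hij]
  have hzero : ∀ j, hA.eigenvalues j = 0 → A *ᵥ w j = 0 := fun j hj =>
    dotProduct_self_eq_zero.1 (by rw [heig, if_pos rfl, hj])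
  have hsplit : ∀ x y, x ⬝ᵥ A *ᵥ y = ∑ j, (x ⬝ᵥ A *ᵥ w j) * (w j ⬝ᵥ y) := by
    intro x y
    have h := hA.eigenvectorBasis.sum_inner_mul_inner (WithLp.toLp 2 (x ᵥ* A)) (WithLp.toLp 2 y)
    simp only [EuclideanSpace.inner_eq_star_dotProduct, star_trivial] at h
    simp only [dotProduct_mulVec]
    rw [dotProduct_comm (x ᵥ* A) y, ← h]
    refine Finset.sum_congr rfl fun j _ => ?_
    rw [dotProduct_comm (x ᵥ* A), dotProduct_comm (w j) y]
  have hself : ∀ i, A *ᵥ w (singIdx A i) ⬝ᵥ A *ᵥ w (singIdx A i) = singVals A i ^ 2 := by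
    intro i
    rw [heig, if_pos rfl, singVals_sq]
  refine ⟨fun i => (singVals A i)⁻¹ • A *ᵥ w (singIdx A i), fun i => w (singIdx A i),
    IsBessel.of_orthogonal ?_ ?_, IsBessel.of_orthogonal ?_ ?_, ?_, ?_⟩
  · intro i j hij
    simp [heig, (singIdx_injective A).ne hij]
  · intro i
    rw [smul_dotProduct, dotProduct_smul, hself]
    rcases eq_or_ne (singVals A i) 0 with h | h
    · simp [h]
    · simp only [smul_eq_mul]
      apply le_of_eq
      field_simp
  · intro i j hij
    simp [horth, (singIdx_injective A).ne hij]
  · intro i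
    simp [horth]
  · intro i
    rw [smul_dotProduct, hself]
    rcases eq_or_ne (singVals A i) 0 with h | h
    · simp [h]
    · simp only [smul_eq_mul]
      field_simp
  · intro x y
    rw [hsplit, ← sum_singIdx A]
    · refine Finset.sum_congr rfl fun i _ => ?_
      rw [smul_dotProduct, smul_eq_mul, dotProduct_comm x]
      rcases eq_or_ne (singVals A i) 0 with h | h
      · have h0 : A *ᵥ w (singIdx A i) = 0 :=
          hzero _ (by rw [← singVals_sq, h]; simp)
        simp [h, h0]
      · field_simp
    · intro j hj
      simp [hzero j hj]

end SVD

/-- Jensen's inequality for a doubly substochastic matrix and a monotone convex function. -/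
theorem sum_map_substochastic_le {ι : Type*} [Fintype ι] {f : ℝ → ℝ}
    (hf : ConvexOn ℝ (Set.Ici 0) f) (hmono : MonotoneOn f (Set.Ici 0))
    {s : ι → ℝ} (hs : ∀ k, 0 ≤ s k) {W : ι → ι → ℝ} (hW : ∀ i k, 0 ≤ W i k)
    (hrow : ∀ i, ∑ k, W i k ≤ 1) (hcol : ∀ k, ∑ i, W i k ≤ 1) :
    ∑ i, f (∑ k, W i k * s k) ≤ ∑ k, f (s k) := by
  have hi : ∀ i, f (∑ k, W i k * s k) ≤ f 0 + ∑ k, W i k * (f (s k) - f 0) := by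
    intro i
    have h := hf.map_add_sum_le (t := Finset.univ) (w := W i) (p := s)
      (v := 1 - ∑ k, W i k) (q := 0) (fun k _ => hW i k) (by ring) (fun k _ => hs k)
      (sub_nonneg.2 (hrow i)) (Set.mem_Ici.2 le_rfl)
    simp only [smul_eq_mul, mul_zero, zero_add] at h
    refine h.trans_eq ?_
    simp only [mul_sub, Finset.sum_sub_distrib, ← Finset.sum_mul]
    ring
  calc ∑ i, f (∑ k, W i k * s k)
      ≤ ∑ i, (f 0 + ∑ k, W i k * (f (s k) - f 0)) := Finset.sum_le_sum fun i _ => hi i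
    _ = ∑ k, (f 0 + (∑ i, W i k) * (f (s k) - f 0)) := by
        rw [Finset.sum_add_distrib, Finset.sum_add_distrib, Finset.sum_comm]
        simp only [Finset.sum_mul]
    _ ≤ ∑ k, f (s k) := Finset.sum_le_sum fun k _ => by
        have h0 : 0 ≤ f (s k) - f 0 :=
          sub_nonneg.2 (hmono (Set.mem_Ici.2 le_rfl) (hs k) (hs k))
        have := mul_le_of_le_one_left h0 (hcol k)
        linarith

theorem sum_map_abs_bilin_le_sum_map_singVals {m n : ℕ} {f : ℝ → ℝ}
    (hf : ConvexOn ℝ (Set.Ici 0) f) (hmono : MonotoneOn f (Set.Ici 0))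
    (A : Matrix (Fin m) (Fin n) ℝ) {u : Fin (min m n) → Fin m → ℝ}
    {v : Fin (min m n) → Fin n → ℝ} (hu : IsBessel u) (hv : IsBessel v) :
    ∑ i, f |u i ⬝ᵥ A *ᵥ v i| ≤ ∑ k, f (singVals A k) := by
  obtain ⟨p, q, hp, hq, -, hA⟩ := exists_singular_vectors A
  let W : Fin (min m n) → Fin (min m n) → ℝ := fun i k =>
    ((p k ⬝ᵥ u i) ^ 2 + (q k ⬝ᵥ v i) ^ 2) / 2
  have hW : ∀ i k, 0 ≤ W i k := fun i k => by positivity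
  refine le_trans (Finset.sum_le_sum fun i _ => ?_)
    (sum_map_substochastic_le hf hmono (singVals_nonneg A) hW (fun i => ?_) fun k => ?_)
  · refine hmono (Set.mem_Ici.2 (abs_nonneg _))
      (Finset.sum_nonneg fun k _ => mul_nonneg (hW i k) (singVals_nonneg A k)) ?_
    rw [hA]
    refine (Finset.abs_sum_le_sum_abs _ _).trans (Finset.sum_le_sum fun k _ => ?_)
    rw [abs_mul, abs_of_nonneg (singVals_nonneg A k), mul_comm]
    refine mul_le_mul_of_nonneg_right (abs_le.2 ?_) (singVals_nonneg A k)
    simp only [W]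
    constructor
    · nlinarith [sq_nonneg (p k ⬝ᵥ u i + q k ⬝ᵥ v i)]
    · nlinarith [sq_nonneg (p k ⬝ᵥ u i - q k ⬝ᵥ v i)]
  · have h₁ := hp.sum_sq_dotProduct_le_one hu i
    have h₂ := hq.sum_sq_dotProduct_le_one hv i
    simp only [W]
    rw [← Finset.sum_div, Finset.sum_add_distrib]
    linarith
  · have h₁ := hu.sum_sq_dotProduct_le_one hp k
    have h₂ := hv.sum_sq_dotProduct_le_one hq k
    simp only [W, dotProduct_comm (p k), dotProduct_comm (q k)]
    rw [← Finset.sum_div, Finset.sum_add_distrib]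
    linarith

theorem convexOn_sum_map_singVals (m n : ℕ) {f : ℝ → ℝ}
    (hf : ConvexOn ℝ (Set.Ici 0) f) (hmono : MonotoneOn f (Set.Ici 0)) :
    ConvexOn ℝ Set.univ (fun A : Matrix (Fin m) (Fin n) ℝ => ∑ k, f (singVals A k)) := by
  refine ⟨convex_univ, fun A _ B _ a b ha hb hab => ?_⟩
  obtain ⟨u, v, hu, hv, hval, -⟩ := exists_singular_vectors (a • A + b • B)
  have hA := sum_map_abs_bilin_le_sum_map_singVals hf hmono A hu hv
  have hB := sum_map_abs_bilin_le_sum_map_singVals hf hmono B hu hv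
  calc ∑ k, f (singVals (a • A + b • B) k)
      ≤ ∑ k, (a * f |u k ⬝ᵥ A *ᵥ v k| + b * f |u k ⬝ᵥ B *ᵥ v k|) := by
        refine Finset.sum_le_sum fun k _ => ?_
        refine le_trans ?_ (hf.2 (abs_nonneg (u k ⬝ᵥ A *ᵥ v k))
          (abs_nonneg (u k ⬝ᵥ B *ᵥ v k)) ha hb hab)
        refine hmono (singVals_nonneg _ k) (Set.mem_Ici.2 (by positivity)) ?_
        rw [← hval k, add_mulVec, smul_mulVec, smul_mulVec, dotProduct_add, dotProduct_smul,
          dotProduct_smul]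
        simp only [smul_eq_mul]
        gcongr <;> exact le_abs_self _
    _ = a * ∑ k, f |u k ⬝ᵥ A *ᵥ v k| + b * ∑ k, f |u k ⬝ᵥ B *ᵥ v k| := by
        rw [Finset.sum_add_distrib, Finset.mul_sum, Finset.mul_sum]
    _ ≤ a • ∑ k, f (singVals A k) + b • ∑ k, f (singVals B k) := by
        simp only [smul_eq_mul]
        gcongr

/-- Let `φ : [0,∞) → [0,∞)` be nondecreasing and `τ, ρ > 0` be such that
`x ↦ x²/(2τ) + ρφ(x)` is convex on `[0,∞)`. Then
`G(A) = ‖A‖_F²/(2τ) + ρ ∑ φ(σ_i(A))` is convex on real `m×n` matrices; consequently, for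
any fixed `A₀`, `H(A) = ‖A − A₀‖_F²/(2τ) + ρ ∑ φ(σ_i(A))` is convex. -/
theorem stmt9 (m n : ℕ) (φ : ℝ → ℝ)
    (hmono : MonotoneOn φ (Set.Ici 0)) (hnn : ∀ x, 0 ≤ x → 0 ≤ φ x)
    (τ ρ : ℝ) (hτ : 0 < τ) (hρ : 0 < ρ)
    (hconv : ConvexOn ℝ (Set.Ici 0) (fun x => x ^ 2 / (2 * τ) + ρ * φ x)) :
    ConvexOn ℝ Set.univ (fun A : Matrix (Fin m) (Fin n) ℝ =>
      (∑ i, ∑ j, (A i j) ^ 2) / (2 * τ) + ρ * ∑ i, φ (singVals A i)) ∧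
    ∀ A₀ : Matrix (Fin m) (Fin n) ℝ,
      ConvexOn ℝ Set.univ (fun A : Matrix (Fin m) (Fin n) ℝ =>
        (∑ i, ∑ j, (A i j - A₀ i j) ^ 2) / (2 * τ) + ρ * ∑ i, φ (singVals A i)) := by
  have hG : ConvexOn ℝ Set.univ (fun A : Matrix (Fin m) (Fin n) ℝ =>
      (∑ i, ∑ j, (A i j) ^ 2) / (2 * τ) + ρ * ∑ i, φ (singVals A i)) := by
    have hm : MonotoneOn (fun x => x ^ 2 / (2 * τ) + ρ * φ x) (Set.Ici 0) := by
      intro x hx y hy hxy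
      have hx0 : (0 : ℝ) ≤ x := hx
      have h := hmono hx hy hxy
      dsimp only
      gcongr
    convert convexOn_sum_map_singVals m n hconv hm using 2 with A
    rw [sum_sq_eq_sum_singVals_sq, Finset.sum_add_distrib, Finset.sum_div, Finset.mul_sum]
  refine ⟨hG, fun A₀ => ?_⟩
  have hL : ConvexOn ℝ Set.univ (fun A : Matrix (Fin m) (Fin n) ℝ =>
      (∑ i, ∑ j, (A₀ i j ^ 2 - 2 * A₀ i j * A i j)) / (2 * τ)) := by
    refine ⟨convex_univ, fun A _ B _ a b _ _ hab => le_of_eq ?_⟩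
    simp only [smul_eq_mul, ← mul_div_assoc, ← add_div, Finset.mul_sum, ← Finset.sum_add_distrib]
    congr 1
    refine Finset.sum_congr rfl fun i _ => Finset.sum_congr rfl fun j _ => ?_
    simp only [Matrix.add_apply, Matrix.smul_apply, smul_eq_mul]
    linear_combination (-(A₀ i j ^ 2)) * hab
  refine (hG.add hL).congr fun A _ => ?_
  have hsq : ∑ i, ∑ j, (A i j - A₀ i j) ^ 2
      = ∑ i, ∑ j, A i j ^ 2 + ∑ i, ∑ j, (A₀ i j ^ 2 - 2 * A₀ i j * A i j) := by
    simp only [← Finset.sum_add_distrib]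
    refine Finset.sum_congr rfl fun i _ => Finset.sum_congr rfl fun j _ => ?_
    ring
  simp only [Pi.add_apply, hsq]
  ring
end

section
/- Let m, n ∈ ℕ, let φ : [0,∞) → [0,∞) be differentiable and nondecreasing, and let τ, ρ > 0 be such that x ↦ x²/(2τ) + ρφ(x) is convex on [0,∞). Let A₀ be a real m×n matrix with singular value decomposition A₀ = U D Vᵀ, where U is an m×m orthogonal matrix, V is an n×n orthogonal matrix, and D is the m×n rectangular diagonal matrix with diagonal entries σ₁ ≥ … ≥ σ_{min(m,n)} ≥ 0. For x₀ ≥ 0 let prox_{τ,ρφ}(x₀) denote the unique minimizer over x ∈ ℝ of x ↦ (x − x₀)²/(2τ) + ρφ(|x|). Then the matrix A* = U D' Vᵀ, where D' is the m×n rectangular diagonal matrix with diagonal entries prox_{τ,ρφ}(σ_i), is a minimizer of the function A ↦ ‖A − A₀‖_F²/(2τ) + ρ ∑_{i=1}^{min(m,n)} φ(σ_i(A)) over all real m×n matrices A. -/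
open Matrix

/-- The `m×n` rectangular diagonal matrix with diagonal entries `σ 0, …, σ (min m n - 1)`. -/
def rectDiag {m n : ℕ} (σ : Fin (min m n) → ℝ) : Matrix (Fin m) (Fin n) ℝ :=
  Matrix.of fun i j =>
    if h : (i : ℕ) = (j : ℕ) then
      σ ⟨(i : ℕ), by have := i.isLt; have := j.isLt; omega⟩
    else 0

/-- Summation by parts: partial-sum domination is preserved by antitone nonnegative weights. -/
theorem sum_antitone_mul_le {N : ℕ} {f x y : Fin N → ℝ} (hf : Antitone f) (hf0 : ∀ i, 0 ≤ f i)
    (h : ∀ r : Fin N, ∑ i, (if i ≤ r then x i else 0) ≤ ∑ i, (if i ≤ r then y i else 0)) :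
    ∑ i, f i * x i ≤ ∑ i, f i * y i := by
  let g : ℕ → ℝ := fun i => if hi : i < N then f ⟨i, hi⟩ else 0
  have hg : ∀ i, g (i + 1) ≤ g i := by
    intro i
    by_cases h1 : i + 1 < N
    · have h2 : i < N := by omega
      simp only [g, h1, h2, dif_pos]
      exact hf (by simp)
    · by_cases h2 : i < N
      · simp only [g, h1, h2, dif_pos, dif_neg, not_false_eq_true]
        exact hf0 _
      · simp [g, h1, h2]
  have hrep : ∀ i : Fin N, f i = ∑ r : Fin N, (if i ≤ r then g r - g (r + 1) else 0) := by
    intro i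
    simp only [Fin.le_def]
    rw [Fin.sum_univ_eq_sum_range (fun r => if (i : ℕ) ≤ r then g r - g (r + 1) else 0) N,
      ← Finset.sum_filter]
    have hIco : (Finset.range N).filter (fun r => (i : ℕ) ≤ r) = Finset.Ico (i : ℕ) N := by
      ext r; simp; tauto
    rw [hIco]
    have := Finset.sum_Ico_sub (fun r => - g r) i.isLt.le
    simp only [neg_sub_neg] at this
    rw [this]
    simp [g]
  have hsum : ∀ z : Fin N → ℝ, ∑ i, f i * z i =
      ∑ r : Fin N, (g r - g (r + 1)) * ∑ i, (if i ≤ r then z i else 0) := by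
    intro z
    simp_rw [Finset.mul_sum]
    rw [Finset.sum_comm]
    refine Finset.sum_congr rfl fun i _ => ?_
    rw [hrep i, Finset.sum_mul]
    refine Finset.sum_congr rfl fun r _ => ?_
    split_ifs <;> simp
  rw [hsum, hsum]
  exact Finset.sum_le_sum fun r _ =>
    mul_le_mul_of_nonneg_left (h r) (sub_nonneg.2 (hg r))

/-- Rearrangement inequality for doubly substochastic weights. -/
theorem sum_mul_mul_le_of_substochastic {k N : ℕ} (hk : k ≤ N) {f : Fin k → ℝ} {g : Fin N → ℝ}
    (hf : Antitone f) (hf0 : ∀ i, 0 ≤ f i) (hg : Antitone g) (hg0 : ∀ i, 0 ≤ g i)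
    {M : Fin k → Fin N → ℝ} (hM : ∀ i j, 0 ≤ M i j) (hrow : ∀ i, ∑ j, M i j ≤ 1)
    (hcol : ∀ j, ∑ i, M i j ≤ 1) :
    ∑ i, f i * ∑ j, g j * M i j ≤ ∑ i, f i * g (Fin.castLE hk i) := by
  refine sum_antitone_mul_le hf hf0 fun r => ?_
  have hl : ∑ i, (if i ≤ r then ∑ j, g j * M i j else 0) =
      ∑ j, g j * ∑ i, (if i ≤ r then M i j else 0) := by
    simp_rw [Finset.mul_sum]
    rw [Finset.sum_comm (s := (Finset.univ : Finset (Fin N)))]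
    refine Finset.sum_congr rfl fun i _ => ?_
    split_ifs <;> simp
  have hcast : ∀ h : Fin N → ℝ, ∑ i, (if i ≤ r then h (Fin.castLE hk i) else 0) =
      ∑ j, h j * (if j ≤ Fin.castLE hk r then 1 else 0) := by
    intro h
    simp_rw [mul_ite, mul_one, mul_zero]
    rw [← Finset.sum_filter, ← Finset.sum_filter]
    refine Finset.sum_bij (fun i _ => Fin.castLE hk i) ?_ ?_ ?_ ?_
    · intro i hi
      exact Finset.mem_filter.2 ⟨Finset.mem_univ _, (Finset.mem_filter.1 hi).2⟩
    · intro a _ b _ hab; simpa using hab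
    · intro j hj
      have hj' : (j : ℕ) ≤ r := (Finset.mem_filter.1 hj).2
      exact ⟨⟨j, hj'.trans_lt r.isLt⟩, Finset.mem_filter.2 ⟨Finset.mem_univ _, hj'⟩, rfl⟩
    · intros; rfl
  rw [hl, hcast]
  refine sum_antitone_mul_le hg hg0 fun t => ?_
  have hite : ∀ (p : Prop) [Decidable p] (a : ℝ), 0 ≤ a → (if p then a else 0) ≤ a := by
    intro p _ a ha; split_ifs <;> simp [ha]
  rcases le_total t (Fin.castLE hk r) with htr | hrt
  · refine Finset.sum_le_sum fun j _ => ?_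
    by_cases hj : j ≤ t
    · rw [if_pos hj, if_pos hj, if_pos (hj.trans htr)]
      exact (Finset.sum_le_sum fun i _ => hite _ _ (hM i j)).trans (hcol j)
    · simp [hj]
  · calc ∑ j, (if j ≤ t then ∑ i, (if i ≤ r then M i j else 0) else 0)
        ≤ ∑ j, ∑ i, (if i ≤ r then M i j else 0) := by
          refine Finset.sum_le_sum fun j _ => hite _ _ (Finset.sum_nonneg fun i _ => ?_)
          split_ifs <;> simp [hM]
      _ = ∑ i, (if i ≤ r then ∑ j, M i j else 0) := by
          rw [Finset.sum_comm]
          refine Finset.sum_congr rfl fun i _ => ?_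
          split_ifs <;> simp
      _ ≤ ∑ i, (if i ≤ r then 1 else 0) := by
          refine Finset.sum_le_sum fun i _ => ?_
          split_ifs <;> simp [hrow]
      _ = ∑ j : Fin N, (if j ≤ t then (if j ≤ Fin.castLE hk r then 1 else 0) else 0) := by
          rw [hcast (fun _ => 1)]
          refine Finset.sum_congr rfl fun j _ => ?_
          by_cases hj : j ≤ Fin.castLE hk r
          · simp [hj, hj.trans hrt]
          · simp [hj]

/-- Pairing with a rectangular diagonal matrix only sees the diagonal. -/
theorem sum_mul_rectDiag {m n : ℕ} (X : Matrix (Fin m) (Fin n) ℝ) (σ : Fin (min m n) → ℝ) :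
    ∑ i, ∑ j, X i j * rectDiag σ i j =
      ∑ l, σ l * X (Fin.castLE (min_le_left m n) l) (Fin.castLE (min_le_right m n) l) := by
  have hrep : ∀ i j, X i j * rectDiag σ i j = ∑ l : Fin (min m n),
      (if i = Fin.castLE (min_le_left m n) l then
        (if j = Fin.castLE (min_le_right m n) l then σ l * X i j else 0) else 0) := by
    intro i j
    by_cases h : (i : ℕ) = j
    · rw [Finset.sum_eq_single ⟨(i : ℕ), by omega⟩]
      · simp [rectDiag, h, Fin.ext_iff, mul_comm]
      · intro b _ hb
        have : ¬ i = Fin.castLE (min_le_left m n) b := by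
          rintro rfl; exact hb (Fin.ext rfl)
        simp [this]
      · simp
    · rw [Finset.sum_eq_zero]
      · simp [rectDiag, h]
      · intro l _
        split_ifs with h1 h2
        · exact absurd (by rw [h1, h2]; rfl) h
        all_goals rfl
  simp_rw [hrep]
  simp_rw [Finset.sum_comm (s := (Finset.univ : Finset (Fin n)))]
  rw [Finset.sum_comm]
  simp

/-- The Frobenius inner product as a trace. -/
theorem sum_mul_eq_trace {m n : ℕ} (A B : Matrix (Fin m) (Fin n) ℝ) :
    ∑ i, ∑ j, A i j * B i j = (Aᵀ * B).trace := by
  rw [Finset.sum_comm]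
  simp [Matrix.trace, Matrix.mul_apply]

theorem sum_mul_conj {m n : ℕ} (A B : Matrix (Fin m) (Fin n) ℝ)
    (U : Matrix (Fin m) (Fin m) ℝ) (V : Matrix (Fin n) (Fin n) ℝ) :
    ∑ i, ∑ j, A i j * (U * B * Vᵀ) i j = ∑ i, ∑ j, (Uᵀ * A * V) i j * B i j := by
  rw [sum_mul_eq_trace, sum_mul_eq_trace, ← Matrix.mul_assoc, Matrix.trace_mul_comm]
  simp [Matrix.mul_assoc]

/-- The Frobenius norm of `U * rectDiag σ * Vᵀ`. -/
theorem sum_sq_conj_rectDiag {m n : ℕ} {U : Matrix (Fin m) (Fin m) ℝ} (hU : Uᵀ * U = 1)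
    {V : Matrix (Fin n) (Fin n) ℝ} (hV : Vᵀ * V = 1) (σ : Fin (min m n) → ℝ) :
    ∑ i, ∑ j, (U * rectDiag σ * Vᵀ) i j ^ 2 = ∑ l, σ l ^ 2 := by
  have hmul : Uᵀ * (U * rectDiag σ * Vᵀ) * V = rectDiag σ := by
    rw [Matrix.mul_assoc U, ← Matrix.mul_assoc Uᵀ, hU, Matrix.one_mul, Matrix.mul_assoc, hV,
      Matrix.mul_one]
  simp_rw [sq]
  rw [sum_mul_conj, hmul, sum_mul_rectDiag]
  simp [rectDiag]

/-- The squared singular values of `A`, padded to length `n`: the eigenvalues of `AᵀA` in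
nonincreasing order. -/
noncomputable def sortedEigs {m n : ℕ} (A : Matrix (Fin m) (Fin n) ℝ) (j : Fin n) : ℝ :=
  (transpose_mul_self_isHermitian A).eigenvalues
    (Tuple.sort (transpose_mul_self_isHermitian A).eigenvalues j.rev)

theorem singVals_eq_sqrt_sortedEigs {m n : ℕ} (A : Matrix (Fin m) (Fin n) ℝ)
    (i : Fin (min m n)) :
    singVals A i = Real.sqrt (sortedEigs A (Fin.castLE (min_le_right m n) i)) := by
  unfold singVals sortedEigs
  congr 3
  ext
  simp [Fin.val_rev]
  omega

theorem sortedEigs_antitone {m n : ℕ} (A : Matrix (Fin m) (Fin n) ℝ) :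
    Antitone (sortedEigs A) := fun _ _ h =>
  Tuple.monotone_sort (transpose_mul_self_isHermitian A).eigenvalues (Fin.rev_le_rev.2 h)

theorem sortedEigs_nonneg {m n : ℕ} (A : Matrix (Fin m) (Fin n) ℝ) (j : Fin n) :
    0 ≤ sortedEigs A j := by
  have h : (Aᵀ * A).PosSemidef := by
    simpa [Matrix.conjTranspose_eq_transpose_of_trivial] using
      Matrix.posSemidef_conjTranspose_mul_self A
  exact h.eigenvalues_nonneg _

theorem sum_sortedEigs {m n : ℕ} (A : Matrix (Fin m) (Fin n) ℝ) (f : ℝ → ℝ) :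
    ∑ j, f (sortedEigs A j) =
      ∑ j, f ((transpose_mul_self_isHermitian A).eigenvalues j) :=
  Equiv.sum_comp (Fin.revPerm.trans
    (Tuple.sort (transpose_mul_self_isHermitian A).eigenvalues))
    (fun j => f ((transpose_mul_self_isHermitian A).eigenvalues j))

/-- The sorted eigenvalues of `AᵀA` are realized by an orthonormal basis of eigenvectors. -/
theorem exists_orthogonal_diagonalization {m n : ℕ} (A : Matrix (Fin m) (Fin n) ℝ) :
    ∃ Q : Matrix (Fin n) (Fin n) ℝ, Qᵀ * Q = 1 ∧
      Qᵀ * (Aᵀ * A) * Q = Matrix.diagonal (sortedEigs A) := by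
  let hA := transpose_mul_self_isHermitian A
  let e : Fin n ≃ Fin n := Fin.revPerm.trans (Tuple.sort hA.eigenvalues)
  let W : Matrix (Fin n) (Fin n) ℝ := hA.eigenvectorUnitary
  have hW : Wᵀ * W = 1 := by
    have := Unitary.coe_star_mul_self hA.eigenvectorUnitary
    simpa [W, Matrix.star_eq_conjTranspose,
      Matrix.conjTranspose_eq_transpose_of_trivial] using this
  have hspec : Wᵀ * (Aᵀ * A) * W = Matrix.diagonal hA.eigenvalues := by
    have := hA.conjStarAlgAut_star_eigenvectorUnitary
    simpa [W, Unitary.conjStarAlgAut_apply, Matrix.star_eq_conjTranspose,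
      Matrix.conjTranspose_eq_transpose_of_trivial, Function.comp_def] using this
  refine ⟨W.submatrix id e, ?_, ?_⟩
  · have : (W.submatrix id e)ᵀ * W.submatrix id e = (Wᵀ * W).submatrix e e := by
      ext i j; simp [Matrix.mul_apply]
    rw [this, hW, Matrix.submatrix_one_equiv]
  · have : (W.submatrix id e)ᵀ * (Aᵀ * A) * W.submatrix id e =
        (Wᵀ * (Aᵀ * A) * W).submatrix e e := by
      ext i j; simp [Matrix.mul_apply]
    rw [this, hspec, Matrix.submatrix_diagonal_equiv]
    rfl

theorem sum_sq_eq_sum_sortedEigs {m n : ℕ} (A : Matrix (Fin m) (Fin n) ℝ) :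
    ∑ i, ∑ j, A i j ^ 2 = ∑ j, sortedEigs A j := by
  simp_rw [sq]
  rw [sum_mul_eq_trace, (transpose_mul_self_isHermitian A).trace_eq_sum_eigenvalues]
  exact (sum_sortedEigs A id).symm

theorem sum_castLE_le {k N : ℕ} (hk : k ≤ N) {f : Fin N → ℝ} (hf : ∀ j, 0 ≤ f j) :
    ∑ i, f (Fin.castLE hk i) ≤ ∑ j, f j := by
  have := Finset.sum_map Finset.univ (Fin.castLEEmb hk) f
  simp only [Fin.coe_castLEEmb] at this
  rw [← this]
  exact Finset.sum_le_sum_of_subset_of_nonneg (Finset.subset_univ _) fun j _ _ => hf j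

/-- A thin singular value decomposition: `A = P * diagonal s * Qᵀ` with `Q` orthogonal and `P`
a partial isometry. -/
theorem exists_thin_svd {m n : ℕ} (A : Matrix (Fin m) (Fin n) ℝ) :
    ∃ (P : Matrix (Fin m) (Fin n) ℝ) (Q : Matrix (Fin n) (Fin n) ℝ), Qᵀ * Q = 1 ∧
      P * Pᵀ * P = P ∧ (∀ j, (Pᵀ * P) j j ≤ 1) ∧
      A = P * Matrix.diagonal (fun j => Real.sqrt (sortedEigs A j)) * Qᵀ := by
  obtain ⟨Q, hQ, hdiag⟩ := exists_orthogonal_diagonalization A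
  set s : Fin n → ℝ := fun j => Real.sqrt (sortedEigs A j)
  have hss : ∀ j, sortedEigs A j = s j * s j := fun j =>
    (Real.mul_self_sqrt (sortedEigs_nonneg A j)).symm
  have hgram : (A * Q)ᵀ * (A * Q) = Matrix.diagonal (sortedEigs A) := by
    rw [← hdiag, Matrix.transpose_mul]
    simp only [Matrix.mul_assoc]
  have hcol : ∀ i j, s j = 0 → (A * Q) i j = 0 := by
    intro i j hj
    have h := congrFun (congrFun hgram j) j
    rw [Matrix.diagonal_apply_eq, hss, hj, mul_zero, Matrix.mul_apply] at h
    have h' := (Finset.sum_eq_zero_iff_of_nonneg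
      (fun l _ => by rw [Matrix.transpose_apply]; exact mul_self_nonneg _)).1 h i
      (Finset.mem_univ i)
    rw [Matrix.transpose_apply] at h'
    exact mul_self_eq_zero.1 h'
  have hPP : (A * Q * Matrix.diagonal (fun j => (s j)⁻¹))ᵀ *
      (A * Q * Matrix.diagonal (fun j => (s j)⁻¹)) =
      Matrix.diagonal (fun j => (s j)⁻¹ * (s j * s j) * (s j)⁻¹) := by
    rw [Matrix.transpose_mul, Matrix.mul_assoc, ← Matrix.mul_assoc _ (A * Q), hgram,
      Matrix.diagonal_transpose, Matrix.diagonal_mul_diagonal, Matrix.diagonal_mul_diagonal]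
    congr 1
    ext j
    rw [hss]; ring
  refine ⟨A * Q * Matrix.diagonal (fun j => (s j)⁻¹), Q, hQ, ?_, ?_, ?_⟩
  · rw [Matrix.mul_assoc (A * Q * Matrix.diagonal fun j => (s j)⁻¹), hPP, Matrix.mul_assoc,
      Matrix.diagonal_mul_diagonal]
    congr 2
    ext j
    by_cases hj : s j = 0
    · simp [hj]
    · field_simp
  · intro j
    rw [hPP, Matrix.diagonal_apply_eq]
    by_cases hj : s j = 0
    · simp [hj]
    · field_simp; exact le_rfl
  · have hAQ : A * Q * Matrix.diagonal (fun j => (s j)⁻¹) * Matrix.diagonal s = A * Q := by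
      ext i j
      rw [Matrix.mul_diagonal, Matrix.mul_diagonal]
      by_cases hj : s j = 0
      · simp [hj, hcol i j hj]
      · field_simp
    rw [hAQ, Matrix.mul_assoc, mul_eq_one_comm.1 hQ, Matrix.mul_one]

/-- Rows of a partial isometry have norm at most one. -/
theorem mul_transpose_self_diag_le_one {m n : ℕ} {Y : Matrix (Fin m) (Fin n) ℝ}
    (hY : Y * Yᵀ * Y = Y) (i : Fin m) : (Y * Yᵀ) i i ≤ 1 := by
  have hidem : (Y * Yᵀ)ᵀ * (Y * Yᵀ) = Y * Yᵀ := by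
    rw [Matrix.transpose_mul, Matrix.transpose_transpose, ← Matrix.mul_assoc, hY]
  have h := congrFun (congrFun hidem i) i
  rw [Matrix.mul_apply] at h
  have hle : (Y * Yᵀ) i i * (Y * Yᵀ) i i ≤ (Y * Yᵀ) i i := by
    conv_rhs => rw [← h]
    exact Finset.single_le_sum (f := fun l => (Y * Yᵀ)ᵀ i l * (Y * Yᵀ) l i)
      (fun l _ => mul_self_nonneg _) (Finset.mem_univ i)
  nlinarith

/-- Von Neumann's trace inequality against a singular value decomposition. -/
theorem sum_mul_conj_rectDiag_le {m n : ℕ} (A : Matrix (Fin m) (Fin n) ℝ)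
    {U : Matrix (Fin m) (Fin m) ℝ} (hU : Uᵀ * U = 1)
    {V : Matrix (Fin n) (Fin n) ℝ} (hV : Vᵀ * V = 1)
    {σ : Fin (min m n) → ℝ} (hσ : Antitone σ) (hσ0 : ∀ i, 0 ≤ σ i) :
    ∑ i, ∑ j, A i j * (U * rectDiag σ * Vᵀ) i j ≤ ∑ l, σ l * singVals A l := by
  obtain ⟨P, Q, hQ, hP, hPcol, hA⟩ := exists_thin_svd A
  set s : Fin n → ℝ := fun j => Real.sqrt (sortedEigs A j)
  let Y := Uᵀ * P
  let X := Vᵀ * Q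
  have hUU : U * Uᵀ = 1 := mul_eq_one_comm.1 hU
  have hVV : V * Vᵀ = 1 := mul_eq_one_comm.1 hV
  have hQQ : Q * Qᵀ = 1 := mul_eq_one_comm.1 hQ
  have hYY : Yᵀ * Y = Pᵀ * P := by
    simp only [Y, Matrix.transpose_mul, Matrix.transpose_transpose]
    rw [Matrix.mul_assoc, ← Matrix.mul_assoc U, hUU, Matrix.one_mul]
  have hY : Y * Yᵀ * Y = Y := by
    rw [Matrix.mul_assoc, hYY]
    simp only [Y]
    rw [Matrix.mul_assoc, ← Matrix.mul_assoc P, hP]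
  have hXX : Xᵀ * X = 1 := by
    simp only [X, Matrix.transpose_mul, Matrix.transpose_transpose]
    rw [Matrix.mul_assoc, ← Matrix.mul_assoc V, hVV, Matrix.one_mul, hQ]
  have hXX' : X * Xᵀ = 1 := mul_eq_one_comm.1 hXX
  have hUAV : Uᵀ * A * V = Y * Matrix.diagonal s * Xᵀ := by
    conv_lhs => rw [hA]
    simp only [X, Y, Matrix.transpose_mul, Matrix.transpose_transpose, Matrix.mul_assoc]
  have hYrow : ∀ i, ∑ j, Y i j ^ 2 ≤ 1 := fun i => by
    simpa [Matrix.mul_apply, sq] using mul_transpose_self_diag_le_one hY i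
  have hYcol : ∀ j, ∑ i, Y i j ^ 2 ≤ 1 := fun j => by
    have := hPcol j
    rw [← hYY] at this
    simpa [Matrix.mul_apply, sq] using this
  have hXrow : ∀ i, ∑ j, X i j ^ 2 ≤ 1 := fun i => by
    have := (congrFun (congrFun hXX' i) i).le
    simpa [Matrix.mul_apply, sq] using this
  have hXcol : ∀ j, ∑ i, X i j ^ 2 ≤ 1 := fun j => by
    have := (congrFun (congrFun hXX j) j).le
    simpa [Matrix.mul_apply, sq] using this
  let M : Fin (min m n) → Fin n → ℝ := fun l j =>
    (Y (Fin.castLE (min_le_left m n) l) j ^ 2 + X (Fin.castLE (min_le_right m n) l) j ^ 2) / 2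
  have hs0 : ∀ j, 0 ≤ s j := fun j => Real.sqrt_nonneg _
  rw [sum_mul_conj, hUAV, sum_mul_rectDiag]
  calc _ ≤ ∑ l, σ l * ∑ j, s j * M l j := by
        refine Finset.sum_le_sum fun l _ => mul_le_mul_of_nonneg_left ?_ (hσ0 l)
        rw [Matrix.mul_apply]
        refine Finset.sum_le_sum fun j _ => ?_
        rw [Matrix.mul_diagonal, Matrix.transpose_apply, mul_right_comm, mul_comm]
        refine mul_le_mul_of_nonneg_left ?_ (hs0 j)
        have := two_mul_le_add_sq (Y (Fin.castLE (min_le_left m n) l) j)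
          (X (Fin.castLE (min_le_right m n) l) j)
        simp only [M]
        linarith
    _ ≤ ∑ l, σ l * s (Fin.castLE (min_le_right m n) l) := by
        refine sum_mul_mul_le_of_substochastic _ hσ hσ0
          (fun _ _ h => Real.sqrt_le_sqrt (sortedEigs_antitone A h)) hs0
          (fun l j => by positivity) (fun l => ?_) (fun j => ?_)
        · simp only [M]
          rw [← Finset.sum_div, Finset.sum_add_distrib]
          linarith [hYrow (Fin.castLE (min_le_left m n) l),
            hXrow (Fin.castLE (min_le_right m n) l)]
        · simp only [M]
          rw [← Finset.sum_div, Finset.sum_add_distrib]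
          linarith [hYcol j, hXcol j,
            sum_castLE_le (min_le_left m n) (f := fun i => Y i j ^ 2) (fun i => sq_nonneg _),
            sum_castLE_le (min_le_right m n) (f := fun i => X i j ^ 2) (fun i => sq_nonneg _)]
    _ = _ := by simp_rw [singVals_eq_sqrt_sortedEigs]; rfl

/-- Mirsky's inequality in Frobenius norm, with one matrix given by its singular value
decomposition. -/
theorem sum_sq_singVals_sub_le {m n : ℕ} (A : Matrix (Fin m) (Fin n) ℝ)
    {U : Matrix (Fin m) (Fin m) ℝ} (hU : Uᵀ * U = 1)
    {V : Matrix (Fin n) (Fin n) ℝ} (hV : Vᵀ * V = 1)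
    {σ : Fin (min m n) → ℝ} (hσ : Antitone σ) (hσ0 : ∀ i, 0 ≤ σ i) :
    ∑ l, (singVals A l - σ l) ^ 2 ≤
      ∑ i, ∑ j, (A i j - (U * rectDiag σ * Vᵀ) i j) ^ 2 := by
  have hnorm : ∑ l, singVals A l ^ 2 ≤ ∑ i, ∑ j, A i j ^ 2 := by
    rw [sum_sq_eq_sum_sortedEigs]
    refine le_trans (le_of_eq ?_) (sum_castLE_le (min_le_right m n) (sortedEigs_nonneg A))
    refine Finset.sum_congr rfl fun l _ => ?_
    rw [singVals_eq_sqrt_sortedEigs, Real.sq_sqrt (sortedEigs_nonneg A _)]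
  have htrace := sum_mul_conj_rectDiag_le A hU hV hσ hσ0
  have hconj := sum_sq_conj_rectDiag hU hV σ
  have hl : ∑ l, (singVals A l - σ l) ^ 2 =
      ∑ l, singVals A l ^ 2 - 2 * ∑ l, σ l * singVals A l + ∑ l, σ l ^ 2 := by
    rw [Finset.mul_sum, ← Finset.sum_sub_distrib, ← Finset.sum_add_distrib]
    exact Finset.sum_congr rfl fun l _ => by ring
  have hr : ∑ i, ∑ j, (A i j - (U * rectDiag σ * Vᵀ) i j) ^ 2 =
      ∑ i, ∑ j, A i j ^ 2 - 2 * ∑ i, ∑ j, A i j * (U * rectDiag σ * Vᵀ) i j +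
        ∑ i, ∑ j, (U * rectDiag σ * Vᵀ) i j ^ 2 := by
    simp_rw [Finset.mul_sum, ← Finset.sum_sub_distrib, ← Finset.sum_add_distrib]
    exact Finset.sum_congr rfl fun i _ => Finset.sum_congr rfl fun j _ => by ring
  rw [hl, hr]
  linarith

theorem transpose_rectDiag_mul_rectDiag {m n : ℕ} (π : Fin (min m n) → ℝ) :
    (rectDiag π)ᵀ * (rectDiag π : Matrix (Fin m) (Fin n) ℝ) =
      Matrix.diagonal (fun j : Fin n => if h : (j : ℕ) < min m n then π ⟨j, h⟩ ^ 2 else 0) := by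
  ext j j'
  rw [Matrix.mul_apply]
  by_cases hj : (j : ℕ) < m
  · rw [Finset.sum_eq_single ⟨(j : ℕ), hj⟩]
    · by_cases hjj : j = j'
      · subst hjj
        simp [rectDiag, hj, sq]
      · have : ¬ (j : ℕ) = j' := fun h => hjj (Fin.ext h)
        simp [rectDiag, hjj, this]
    · intro b _ hb
      have : ¬ (b : ℕ) = j := fun h => hb (Fin.ext h)
      simp [rectDiag, this]
    · simp
  · rw [Finset.sum_eq_zero]
    · by_cases hjj : j = j'
      · subst hjj
        simp [hj]
      · simp [hjj]
    · intro b _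
      have : ¬ (b : ℕ) = j := fun h => hj (h ▸ b.isLt)
      simp [rectDiag, this]

/-- A symmetric function of the eigenvalues of `AᵀA` when `A = U * rectDiag π * Vᵀ`. -/
theorem sum_eigenvalues_conj_rectDiag {m n : ℕ} {U : Matrix (Fin m) (Fin m) ℝ}
    (hU : Uᵀ * U = 1) {V : Matrix (Fin n) (Fin n) ℝ} (hV : Vᵀ * V = 1)
    (π : Fin (min m n) → ℝ) (f : ℝ → ℝ) :
    ∑ j, f (sortedEigs (U * rectDiag π * Vᵀ) j) =
      ∑ j : Fin n, f (if h : (j : ℕ) < min m n then π ⟨j, h⟩ ^ 2 else 0) := by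
  rw [sum_sortedEigs]
  set A := U * rectDiag π * Vᵀ with hA
  have hgram : Aᵀ * A = V * (((rectDiag π)ᵀ * (rectDiag π : Matrix (Fin m) (Fin n) ℝ)) * Vᵀ) := by
    simp only [hA, Matrix.transpose_mul, Matrix.transpose_transpose, Matrix.mul_assoc]
    rw [← Matrix.mul_assoc Uᵀ, hU, Matrix.one_mul]
  set d : Fin n → ℝ := fun j => if h : (j : ℕ) < min m n then π ⟨j, h⟩ ^ 2 else 0
  have hchar : (Aᵀ * A).charpoly = ((Finset.univ.val.map d).map
      fun a => Polynomial.X - Polynomial.C a).prod := by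
    rw [hgram, Matrix.charpoly_mul_comm, Matrix.mul_assoc, hV, Matrix.mul_one,
      transpose_rectDiag_mul_rectDiag, Matrix.charpoly_diagonal, Multiset.map_map]
    rfl
  have hroots := (transpose_mul_self_isHermitian A).roots_charpoly_eq_eigenvalues
  rw [hchar, Polynomial.roots_multiset_prod_X_sub_C] at hroots
  have hsum := congrArg (fun s : Multiset ℝ => (s.map f).sum) hroots
  simp only [Multiset.map_map] at hsum
  exact hsum.symm

theorem sum_singVals_conj_rectDiag_le {m n : ℕ} {φ : ℝ → ℝ} (hφ : MonotoneOn φ (Set.Ici 0))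
    {U : Matrix (Fin m) (Fin m) ℝ} (hU : Uᵀ * U = 1)
    {V : Matrix (Fin n) (Fin n) ℝ} (hV : Vᵀ * V = 1) (π : Fin (min m n) → ℝ) :
    ∑ l, φ (singVals (U * rectDiag π * Vᵀ) l) ≤ ∑ l, φ |π l| := by
  have hsub : ∀ x, 0 ≤ φ (Real.sqrt x) - φ 0 := fun x =>
    sub_nonneg.2 (hφ Set.self_mem_Ici (Real.sqrt_nonneg x) (Real.sqrt_nonneg x))
  have key : ∑ l, (φ (singVals (U * rectDiag π * Vᵀ) l) - φ 0) ≤ ∑ l, (φ |π l| - φ 0) := by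
    simp_rw [singVals_eq_sqrt_sortedEigs]
    refine (sum_castLE_le (min_le_right m n) (fun j =>
      hsub (sortedEigs (U * rectDiag π * Vᵀ) j))).trans (le_of_eq ?_)
    rw [sum_eigenvalues_conj_rectDiag hU hV π (fun x => φ (Real.sqrt x) - φ 0)]
    have := Finset.sum_map Finset.univ (Fin.castLEEmb (min_le_right m n)) (fun j : Fin n =>
      φ (Real.sqrt (if h : (j : ℕ) < min m n then π ⟨j, h⟩ ^ 2 else 0)) - φ 0)
    rw [← Finset.sum_subset (Finset.subset_univ
      (Finset.univ.map (Fin.castLEEmb (min_le_right m n)))), this]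
    · refine Finset.sum_congr rfl fun l _ => ?_
      have hl : (l : ℕ) < min m n := l.isLt
      rw [Fin.coe_castLEEmb, dif_pos (show (Fin.castLE (min_le_right m n) l : ℕ) < min m n from hl),
        Real.sqrt_sq_eq_abs]
      rfl
    · intro j _ hj
      have hjk : ¬ (j : ℕ) < min m n := fun h =>
        hj (Finset.mem_map.2 ⟨⟨j, h⟩, Finset.mem_univ _, rfl⟩)
      simp only [hjk, dif_neg, not_false_eq_true, Real.sqrt_zero, sub_self]
  rw [Finset.sum_sub_distrib, Finset.sum_sub_distrib] at key
  linarith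

/-- Let `φ : [0,∞) → [0,∞)` be differentiable and nondecreasing, and
`τ, ρ > 0` with `x ↦ x²/(2τ) + ρφ(x)` convex on `[0,∞)`. Let `A₀ = U D Vᵀ` be an SVD of
`A₀` (with `U`, `V` orthogonal and `D` rectangular diagonal with nonincreasing nonnegative
entries `σᵢ`), and let `π i` be the minimizer of `x ↦ (x − σᵢ)²/(2τ) + ρφ(|x|)` (the scalar
proximal map `prox_{τ,ρφ}(σᵢ)`). Then `A* = U D' Vᵀ`, with `D'` rectangular diagonal with
entries `π i`, minimizes `A ↦ ‖A − A₀‖_F²/(2τ) + ρ ∑ φ(σ_i(A))` over all `m×n` matrices. -/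
theorem stmt10 (m n : ℕ) (φ : ℝ → ℝ)
    (hdiff : DifferentiableOn ℝ φ (Set.Ici 0))
    (hmono : MonotoneOn φ (Set.Ici 0)) (hnn : ∀ x, 0 ≤ x → 0 ≤ φ x)
    (τ ρ : ℝ) (hτ : 0 < τ) (hρ : 0 < ρ)
    (hconv : ConvexOn ℝ (Set.Ici 0) (fun x => x ^ 2 / (2 * τ) + ρ * φ x))
    (U : Matrix (Fin m) (Fin m) ℝ) (hU : Uᵀ * U = 1)
    (V : Matrix (Fin n) (Fin n) ℝ) (hV : Vᵀ * V = 1)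
    (σ : Fin (min m n) → ℝ) (hσa : Antitone σ) (hσnn : ∀ i, 0 ≤ σ i)
    (A₀ : Matrix (Fin m) (Fin n) ℝ) (hA₀ : A₀ = U * rectDiag σ * Vᵀ)
    (π : Fin (min m n) → ℝ)
    (hπ : ∀ i, ∀ x : ℝ,
      (π i - σ i) ^ 2 / (2 * τ) + ρ * φ |π i| ≤ (x - σ i) ^ 2 / (2 * τ) + ρ * φ |x|) :
    ∀ A : Matrix (Fin m) (Fin n) ℝ,
      (∑ i, ∑ j, ((U * rectDiag π * Vᵀ) i j - A₀ i j) ^ 2) / (2 * τ) +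
          ρ * ∑ i, φ (singVals (U * rectDiag π * Vᵀ) i) ≤
        (∑ i, ∑ j, (A i j - A₀ i j) ^ 2) / (2 * τ) + ρ * ∑ i, φ (singVals A i) := by
  intro A
  have hstar : ∑ i, ∑ j, ((U * rectDiag π * Vᵀ) i j - A₀ i j) ^ 2 = ∑ l, (π l - σ l) ^ 2 := by
    rw [← sum_sq_conj_rectDiag hU hV, hA₀]
    have hsub : U * rectDiag (fun l => π l - σ l) * Vᵀ =
        U * rectDiag π * Vᵀ - U * rectDiag σ * Vᵀ := by
      rw [← Matrix.sub_mul, ← Matrix.mul_sub]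
      congr 2
      ext i j
      by_cases h : (i : ℕ) = j <;> simp [rectDiag, h]
    simp [hsub]
  have hmirsky := sum_sq_singVals_sub_le A hU hV hσa hσnn
  rw [← hA₀] at hmirsky
  rw [hstar]
  calc (∑ l, (π l - σ l) ^ 2) / (2 * τ) + ρ * ∑ l, φ (singVals (U * rectDiag π * Vᵀ) l)
      ≤ (∑ l, (π l - σ l) ^ 2) / (2 * τ) + ρ * ∑ l, φ |π l| :=
        add_le_add_right (mul_le_mul_of_nonneg_left
          (sum_singVals_conj_rectDiag_le hmono hU hV π) hρ.le) _
    _ ≤ (∑ l, (singVals A l - σ l) ^ 2) / (2 * τ) + ρ * ∑ l, φ (singVals A l) := by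
        rw [Finset.sum_div, Finset.sum_div, Finset.mul_sum, Finset.mul_sum,
          ← Finset.sum_add_distrib, ← Finset.sum_add_distrib]
        refine Finset.sum_le_sum fun l _ => ?_
        have h := hπ l (singVals A l)
        rwa [abs_of_nonneg (show 0 ≤ singVals A l from Real.sqrt_nonneg _)] at h
    _ ≤ _ := by gcongr
end
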